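/- arXiv:2401.07195 — 2 statements merged into one kernel-verified Lean document; each statement's English description precedes it below -/
import Mathlib

section
/- For every integer j ≥ 1 there exists a polynomial P ∈ ℤ[X₁,…,X_j] which is isobaric of weight j when X_s is given weight s (i.e., every monomial X₁^{β₁}⋯X_j^{β_j} occurring in P satisfies β₁ + 2β₂ + ⋯ + jβ_j = j), such that for every open set U ⊆ ℂ, every holomorphic function u on U with u(z) ≠ 0 for all z ∈ U, and every z ∈ U, the (j−1)-st derivative of the holomorphic function u′/u at z equals P evaluated at (u′(z)/u(z), u″(z)/u(z), …, u^{(j)}(z)/u(z)). -/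
/-- The Leibniz rule for `u' = u * (u' / u)`, solved for the derivative of highest order of the
logarithmic derivative. -/
theorem iteratedDeriv_deriv_div_self {u : ℂ → ℂ} {z : ℂ} (hu : AnalyticAt ℂ u z) (hz : u z ≠ 0)
    (n : ℕ) :
    iteratedDeriv n (fun w => deriv u w / u w) z = iteratedDeriv (n + 1) u z / u z -
      ∑ k ∈ Finset.range n, (n.choose k : ℂ) * (iteratedDeriv (n - k) u z / u z *
        iteratedDeriv k (fun w => deriv u w / u w) z) := by
  have hL : AnalyticAt ℂ (fun w => deriv u w / u w) z := hu.deriv.div hu hz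
  have hev : deriv u =ᶠ[nhds z] (fun w => deriv u w / u w) * u := by
    filter_upwards [hu.continuousAt.eventually_ne hz] with w hw
    simp [div_mul_cancel₀ _ hw]
  have h : iteratedDeriv (n + 1) u z = ∑ k ∈ Finset.range (n + 1), (n.choose k : ℂ) *
      iteratedDeriv k (fun w => deriv u w / u w) z * iteratedDeriv (n - k) u z := by
    rw [iteratedDeriv_succ', hev.iteratedDeriv_eq n,
      iteratedDeriv_mul hL.contDiffAt hu.contDiffAt]
  rw [Finset.sum_range_succ] at h
  simp only [Nat.choose_self, Nat.cast_one, one_mul, Nat.sub_self, iteratedDeriv_zero] at h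
  rw [h, add_div, mul_div_cancel_right₀ _ hz, Finset.sum_div, eq_sub_iff_add_eq, add_comm]
  congr 1
  exact Finset.sum_congr rfl fun k _ => by ring

open MvPolynomial in
/-- The `n`-th derivative of `u' / u` is a universal isobaric polynomial of weight `n + 1` in the
quotients `u^{(s)} / u`. -/
theorem exists_isWeightedHomogeneous_iteratedDeriv_deriv_div_self (j n : ℕ) (hn : n < j) :
    ∃ P : MvPolynomial (Fin j) ℤ,
      P.IsWeightedHomogeneous (fun s : Fin j => s.1 + 1) (n + 1) ∧
      ∀ (u : ℂ → ℂ) (z : ℂ), AnalyticAt ℂ u z → u z ≠ 0 →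
        iteratedDeriv n (fun w => deriv u w / u w) z
          = aeval (fun s : Fin j => iteratedDeriv (s.1 + 1) u z / u z) P := by
  induction n using Nat.strong_induction_on with
  | _ n ih =>
    choose P hP hPu using fun k : Fin n => ih k k.2 (k.2.trans hn)
    refine ⟨X ⟨n, hn⟩ - ∑ k : Fin n, C (n.choose k : ℤ) *
      (X ⟨n - k - 1, by omega⟩ * P k), ?_, fun u z hu hz => ?_⟩
    · refine (isWeightedHomogeneous_X ℤ _ _).sub
        (IsWeightedHomogeneous.sum _ _ _ fun k _ => IsWeightedHomogeneous.C_mul ?_ _)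
      have hk : n + 1 = (n - k - 1 + 1) + (k + 1) := by omega
      rw [hk]
      exact (isWeightedHomogeneous_X ℤ (fun s : Fin j => s.1 + 1) ⟨n - k - 1, by omega⟩).mul (hP k)
    · rw [iteratedDeriv_deriv_div_self hu hz, Finset.sum_range]
      simp only [map_sub, map_sum, map_mul, aeval_X, aeval_C, ← hPu _ u z hu hz]
      congr 1
      refine Finset.sum_congr rfl fun k _ => ?_
      rw [Nat.sub_add_cancel (by omega : 1 ≤ n - k)]
      simp

/-- For every integer `j ≥ 1` there exists an isobaric polynomial
`P ∈ ℤ[X₁,…,X_j]` of weight `j` (the variable `X_s`, encoded by the index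
`s : Fin j` with `X_{s+1}`, has weight `s+1`), such that for every open `U ⊆ ℂ`,
every nowhere-zero holomorphic `u` on `U` and every `z ∈ U`, the `(j−1)`-st
derivative of `u′/u` at `z` equals `P` evaluated at
`(u′(z)/u(z), u″(z)/u(z), …, u^{(j)}(z)/u(z))`. -/
theorem dlog_as_isobaric_polynomial (j : ℕ) (hj : 1 ≤ j) :
    ∃ P : MvPolynomial (Fin j) ℤ,
      (∀ m ∈ P.support, (∑ s : Fin j, (s.1 + 1) * m s) = j) ∧
      ∀ U : Set ℂ, IsOpen U → ∀ u : ℂ → ℂ, DifferentiableOn ℂ u U →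
        (∀ z ∈ U, u z ≠ 0) → ∀ z ∈ U,
          iteratedDeriv (j - 1) (fun w => deriv u w / u w) z
            = MvPolynomial.aeval
                (fun s : Fin j => iteratedDeriv (s.1 + 1) u z / u z) P := by
  obtain ⟨P, hP, hPu⟩ :=
    exists_isWeightedHomogeneous_iteratedDeriv_deriv_div_self j (j - 1) (by omega)
  refine ⟨P, fun m hm => ?_, fun U hU u hu hne z hz =>
    hPu u z (hu.analyticAt (hU.mem_nhds hz)) (hne z hz)⟩
  have h := hP (MvPolynomial.mem_support_iff.mp hm)
  rw [Finsupp.weight_apply, Finsupp.sum_fintype _ _ (by simp), Nat.sub_add_cancel hj] at h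
  simpa [mul_comm] using h
end

section
/- For every integer j ≥ 1 there exists a polynomial P ∈ ℤ[X₁,…,X_j] which is isobaric of weight j when X_s is given weight s (i.e., every monomial X₁^{β₁}⋯X_j^{β_j} occurring in P satisfies β₁ + 2β₂ + ⋯ + jβ_j = j), such that for every open set U ⊆ ℂ, every holomorphic function u on U with u(z) ≠ 0 for all z ∈ U, and every z ∈ U, one has u^{(j)}(z)/u(z) = P evaluated at (L₀(z), L₁(z), …, L_{j−1}(z)), where L_s denotes the s-th complex derivative of the holomorphic function u′/u on U (so that the variable X_s is evaluated at L_{s−1}(z)). -/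
/-- If `u` is analytic and nonzero at `z`, the Leibniz rule applied to `u' = (u'/u) u` expresses
the derivatives of `u` recursively through those of `u'/u`. -/
theorem AnalyticAt.iteratedDeriv_succ_eq_sum_iteratedDeriv_logDeriv {u : ℂ → ℂ} {z : ℂ}
    (hu : AnalyticAt ℂ u z) (hz : u z ≠ 0) (n : ℕ) :
    iteratedDeriv (n + 1) u z = ∑ i ∈ Finset.range (n + 1),
      (n.choose i : ℂ) * iteratedDeriv i (fun w => deriv u w / u w) z *
        iteratedDeriv (n - i) u z := by
  have heq : deriv u =ᶠ[nhds z] (fun w => deriv u w / u w) * u := by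
    filter_upwards [hu.continuousAt.eventually_ne hz] with w hw
    simp [div_mul_cancel₀ _ hw]
  rw [iteratedDeriv_succ', heq.iteratedDeriv_eq,
    iteratedDeriv_mul (hu.deriv.fun_div hu hz).contDiffAt hu.contDiffAt]

/-- The polynomials expressing `u⁽ⁿ⁾ / u` through the derivatives of `u' / u`, in any number
`N ≥ n` of variables. -/
theorem exists_isWeightedHomogeneous_iteratedDeriv_div_eq_aeval (N n : ℕ) (hn : n ≤ N) :
    ∃ P : MvPolynomial (Fin N) ℤ,
      P.IsWeightedHomogeneous (fun s : Fin N => s.1 + 1) n ∧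
      ∀ (u : ℂ → ℂ) (z : ℂ), AnalyticAt ℂ u z → u z ≠ 0 →
        iteratedDeriv n u z / u z =
          MvPolynomial.aeval
            (fun s : Fin N => iteratedDeriv s.1 (fun w => deriv u w / u w) z) P := by
  induction n using Nat.strong_induction_on with
  | _ n ih =>
    rcases n with _ | n
    · exact ⟨1, MvPolynomial.isWeightedHomogeneous_one _ _, fun u z _ hz => by simp [hz]⟩
    choose! P hP hPu using ih
    refine ⟨∑ i : Fin (n + 1), MvPolynomial.C (n.choose i : ℤ) *
      MvPolynomial.X (Fin.castLE hn i) * P (n - i), ?_, fun u z hu hz => ?_⟩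
    · refine MvPolynomial.IsWeightedHomogeneous.sum _ _ _ fun i _ => ?_
      have h := ((MvPolynomial.isWeightedHomogeneous_C (fun s : Fin N => s.1 + 1)
        (n.choose i : ℤ)).mul (MvPolynomial.isWeightedHomogeneous_X ℤ _ (Fin.castLE hn i))).mul
        (hP (n - i) (by lia) (by lia))
      convert h using 1
      simp only [Fin.val_castLE]
      lia
    · rw [hu.iteratedDeriv_succ_eq_sum_iteratedDeriv_logDeriv hz, Finset.sum_div,
        Finset.sum_range, map_sum]
      refine Finset.sum_congr rfl fun i _ => ?_
      simp [mul_div_assoc, hPu (n - i) (by lia) (by lia) u z hu hz]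


/-- For every integer `j ≥ 1` there exists an isobaric polynomial
`P ∈ ℤ[X₁,…,X_j]` of weight `j` (the variable `X_s`, encoded by the index
`s : Fin j` with `X_{s+1}`, has weight `s+1`), such that for every open `U ⊆ ℂ`,
every nowhere-zero holomorphic `u` on `U` and every `z ∈ U`, one has
`u^{(j)}(z)/u(z) = P(L₀(z),…,L_{j−1}(z))`, where `L_s` is the `s`-th derivative
of `u′/u` (so `X_{s+1}`, i.e. the index `s : Fin j`, is evaluated at `L_s(z)`). -/
theorem deriv_quotient_as_isobaric_polynomial_of_dlog (j : ℕ) (hj : 1 ≤ j) :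
    ∃ P : MvPolynomial (Fin j) ℤ,
      (∀ m ∈ P.support, (∑ s : Fin j, (s.1 + 1) * m s) = j) ∧
      ∀ U : Set ℂ, IsOpen U → ∀ u : ℂ → ℂ, DifferentiableOn ℂ u U →
        (∀ z ∈ U, u z ≠ 0) → ∀ z ∈ U,
          iteratedDeriv j u z / u z
            = MvPolynomial.aeval
                (fun s : Fin j =>
                  iteratedDeriv s.1 (fun w => deriv u w / u w) z) P := by
  obtain ⟨P, hP, hPu⟩ := exists_isWeightedHomogeneous_iteratedDeriv_div_eq_aeval j j le_rfl
  refine ⟨P, fun m hm => ?_, fun U hU u hu hne z hz =>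
    hPu u z (hu.analyticAt (hU.mem_nhds hz)) (hne z hz)⟩
  have h := hP (MvPolynomial.mem_support_iff.mp hm)
  rw [Finsupp.weight_apply, Finsupp.sum_fintype _ _ (by simp)] at h
  simpa [mul_comm] using h
end
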